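/- Let n ≥ 2 be an even integer. Let σ be a k-algebra automorphism of k[x1,x2,x3] such that for each of the four polynomials u1 = x1, u2 = x3, u3 = x1·P_{n-1}(x3) + x2·P_n(x3), and u4 = Q_n(x1)·x2 + Q_{n-1}(x1)·x3, there exist α ∈ k^* and β ∈ k (depending on the polynomial) with σ(u_i) = α·u_i + β. Then there exist a, c ∈ {1, −1} with σ(x1) = a·x1, σ(x2) = a·c·x2, and σ(x3) = c·x3. In particular, the set of such automorphisms σ is finite (of cardinality at most 4). -/

import Mathlib

open MvPolynomial

/-- `Pseq k n` is the polynomial `P_{n-1}`: `P_{-1} = 0`, `P_0 = 1`,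
`P_n = X·P_{n-1} + P_{n-2}` for `n ≥ 1`. -/
noncomputable def Pseq (k : Type) [Field k] : ℕ → Polynomial k
  | 0 => 0
  | 1 => 1
  | (n + 2) => Polynomial.X * Pseq k (n + 1) + Pseq k n

/-- `Qseq k n` is the polynomial `Q_{n-1}`: `Q_{-1} = 0`, `Q_0 = 1`,
`Q_n = -X·Q_{n-1} + Q_{n-2}` for `n ≥ 1`. -/
noncomputable def Qseq (k : Type) [Field k] : ℕ → Polynomial k
  | 0 => 0
  | 1 => 1
  | (n + 2) => -Polynomial.X * Qseq k (n + 1) + Qseq k n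

/-- `σ` multiplies each of the four polynomials `x1`, `x3`,
`x1·P_{n-1}(x3) + x2·P_n(x3)`, `Q_n(x1)·x2 + Q_{n-1}(x1)·x3` by a nonzero scalar, up to
an additive constant. Here `P_m = Pseq k (m+1)` and `Q_m = Qseq k (m+1)`. -/
def FixesAxisSegment (k : Type) [Field k] (n : ℕ)
    (σ : MvPolynomial (Fin 3) k ≃ₐ[k] MvPolynomial (Fin 3) k) : Prop :=
  ∀ u ∈ ({X 0, X 2,
      X 0 * Polynomial.aeval (X 2 : MvPolynomial (Fin 3) k) (Pseq k n)
        + X 1 * Polynomial.aeval (X 2 : MvPolynomial (Fin 3) k) (Pseq k (n + 1)),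
      Polynomial.aeval (X 0 : MvPolynomial (Fin 3) k) (Qseq k (n + 1)) * X 1
        + Polynomial.aeval (X 0 : MvPolynomial (Fin 3) k) (Qseq k n) * X 2} :
      Set (MvPolynomial (Fin 3) k)),
    ∃ α β : k, α ≠ 0 ∧ σ u = C α * u + C β

section PseqLemmas

variable (k : Type) [Field k]

theorem Pseq_comp_neg_X (m : ℕ) :
    (Pseq k m).comp (-Polynomial.X) = (-1) ^ (m + 1) * Pseq k m := by
  induction m using Nat.twoStepInduction with
  | zero => simp [Pseq]
  | one => simp [Pseq]
  | more m ih₀ ih₁ =>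
    simp only [Pseq, Polynomial.add_comp, Polynomial.mul_comp, Polynomial.X_comp, ih₀, ih₁]
    ring

theorem Qseq_eq_Pseq_comp (m : ℕ) : Qseq k m = (Pseq k m).comp (-Polynomial.X) := by
  induction m using Nat.twoStepInduction with
  | zero => simp [Pseq, Qseq]
  | one => simp [Pseq, Qseq]
  | more m ih₀ ih₁ =>
    simp only [Pseq, Qseq, Polynomial.add_comp, Polynomial.mul_comp, Polynomial.X_comp, ih₀, ih₁]

theorem natDegree_Pseq_le (m : ℕ) : (Pseq k (m + 1)).natDegree ≤ m := by
  induction m using Nat.twoStepInduction with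
  | zero => simp [Pseq]
  | one => simp [Pseq]
  | more m ih₀ ih₁ =>
    rw [Pseq]
    refine Polynomial.natDegree_add_le_of_degree_le ?_ (ih₀.trans (by omega))
    refine Polynomial.natDegree_mul_le.trans ?_
    rw [Polynomial.natDegree_X]
    omega

theorem coeff_Pseq_self (m : ℕ) : (Pseq k (m + 1)).coeff m = 1 := by
  induction m with
  | zero => simp [Pseq]
  | succ m ih =>
    rw [Pseq, Polynomial.coeff_add, Polynomial.coeff_X_mul, ih]
    cases m with
    | zero => simp [Pseq]
    | succ m =>
      rw [Polynomial.coeff_eq_zero_of_natDegree_lt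
        ((natDegree_Pseq_le k m).trans_lt (by omega)), add_zero]

theorem natDegree_Pseq (m : ℕ) : (Pseq k (m + 1)).natDegree = m :=
  Polynomial.natDegree_eq_of_le_of_coeff_ne_zero (natDegree_Pseq_le k m)
    (by simp [coeff_Pseq_self])

theorem coeff_Pseq_low (j : ℕ) :
    (Pseq k (2 * j)).coeff 0 = 0 ∧ (Pseq k (2 * j)).coeff 1 = j ∧
      (Pseq k (2 * j + 1)).coeff 0 = 1 ∧ 2 * (Pseq k (2 * j + 1)).coeff 2 = j * (j + 1) := by
  induction j with
  | zero => simp [Pseq, Polynomial.coeff_one]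
  | succ j ih =>
    obtain ⟨h₀, h₁, h₂, h₃⟩ := ih
    have e : 2 * (j + 1) = 2 * j + 2 := by ring
    simp only [e, Pseq, Polynomial.coeff_add, Polynomial.coeff_X_mul, Polynomial.coeff_X_mul_zero,
      h₀, h₁, h₂]
    refine ⟨by simp, by push_cast; ring, by simp, ?_⟩
    push_cast
    linear_combination h₃

theorem Pseq_ne_zero (m : ℕ) : Pseq k (m + 1) ≠ 0 := by
  intro h
  simpa [h] using coeff_Pseq_self k m

end PseqLemmas

section Rigidity

variable {k : Type} [Field k] {n : ℕ}

/-- A multiple of `p` of smaller degree vanishes. -/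
theorem eq_zero_of_mul_eq_of_natDegree_lt {p q r : Polynomial k} (h : r * p = q)
    (hd : q.natDegree < p.natDegree) : q = 0 := by
  by_contra hq
  exact absurd (Polynomial.natDegree_le_of_dvd (Dvd.intro_left r h) hq) (by omega)

theorem Qseq_eq_Pseq_of_even (hne : Even n) : Qseq k (n + 1) = Pseq k (n + 1) := by
  rw [Qseq_eq_Pseq_comp, Pseq_comp_neg_X, Even.neg_one_pow (by simpa [Nat.even_add_one]),
    one_mul]

variable [CharZero k]

theorem sq_eq_one_of_Pseq_comp_C_mul_X (hn : 2 ≤ n) (hne : Even n) {c l : k}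
    (h : Polynomial.C l * (Pseq k (n + 1)).comp (Polynomial.C c * Polynomial.X) = Pseq k (n + 1)) :
    l = 1 ∧ (c = 1 ∨ c = -1) := by
  obtain ⟨j, rfl⟩ := even_iff_exists_two_mul.1 hne
  obtain ⟨-, -, h₀, h₂⟩ := coeff_Pseq_low k j
  have e₀ := congrArg (Polynomial.coeff · 0) h
  have e₂ := congrArg (Polynomial.coeff · 2) h
  simp only [Polynomial.coeff_C_mul, Polynomial.comp_C_mul_X_coeff, h₀, pow_zero, mul_one]
    at e₀ e₂
  have hj : (j : k) * (j + 1) ≠ 0 := by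
    have : (j : k) ≠ 0 := by
      rw [Nat.cast_ne_zero]
      omega
    exact mul_ne_zero this (by exact_mod_cast j.succ_ne_zero)
  refine ⟨e₀, eq_or_eq_neg_of_sq_eq_sq c 1 (mul_left_cancel₀ hj ?_)⟩
  rw [e₀, one_mul] at e₂
  linear_combination 2 * e₂ - (c ^ 2 - 1) * h₂

theorem eq_zero_of_Pseq_comp_affine (hn : 2 ≤ n) (hne : Even n) {c d l : k} (hc : c ≠ 0)
    (hl : l ≠ 0)
    (h : Polynomial.C l * (Pseq k (n + 1)).comp (Polynomial.C c * Polynomial.X + Polynomial.C d) =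
      Pseq k (n + 1)) : d = 0 := by
  by_contra hd
  set p := Pseq k (n + 1) with hp
  have heven (x : k) : p.eval (-x) = p.eval x := by
    have := congrArg (Polynomial.eval x) (Pseq_comp_neg_X k (n + 1))
    rw [Even.neg_one_pow (by simpa [Nat.even_add_one])] at this
    simpa using this
  have haff (x : k) : l * p.eval (c * x + d) = p.eval x := by
    simpa using congrArg (Polynomial.eval x) h
  have hper (x : k) : p.eval (x + 2 * d) = p.eval x := by
    have h₁ := haff ((x + d) / c)
    have h₂ := haff (-((x + d) / c))
    rw [heven, ← h₁, mul_neg, mul_div_cancel₀ _ hc, ← heven] at h₂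
    have := mul_left_cancel₀ hl h₂
    ring_nf at this ⊢
    exact this.symm
  have hmul (i : ℕ) : p.eval (i * (2 * d)) = p.eval 0 := by
    induction i with
    | zero => simp
    | succ i ih => rw [Nat.cast_succ, add_one_mul, hper, ih]
  have hconst : p = Polynomial.C (p.eval 0) := by
    refine Polynomial.eq_of_infinite_eval_eq _ _ (Set.Infinite.mono ?_
      (Set.infinite_range_of_injective (f := fun i : ℕ => (i : k) * (2 * d)) ?_))
    · rintro _ ⟨i, rfl⟩
      simpa using hmul i
    · intro i j hij
      simpa [hd] using hij
  have := congrArg Polynomial.natDegree hconst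
  rw [hp, natDegree_Pseq, Polynomial.natDegree_C] at this
  omega

end Rigidity

theorem FixesAxisSegment.diagonal {k : Type} [Field k] [CharZero k] {n : ℕ} (hn : 2 ≤ n)
    (hne : Even n) {σ : MvPolynomial (Fin 3) k ≃ₐ[k] MvPolynomial (Fin 3) k}
    (hσ : FixesAxisSegment k n σ) :
    ∃ a c : k, (a = 1 ∨ a = -1) ∧ (c = 1 ∨ c = -1) ∧
      σ (X 0) = C a * X 0 ∧ σ (X 1) = C (a * c) * X 1 ∧ σ (X 2) = C c * X 2 := by
  obtain ⟨a, b, ha, h₁⟩ := hσ (X 0) (by simp)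
  obtain ⟨c, d, hc, h₂⟩ := hσ (X 2) (by simp)
  obtain ⟨e, f, he, h₃⟩ := hσ (X 0 * Polynomial.aeval (X 2) (Pseq k n)
    + X 1 * Polynomial.aeval (X 2) (Pseq k (n + 1))) (by simp)
  obtain ⟨g, h, hg, h₄⟩ := hσ (Polynomial.aeval (X 0) (Qseq k (n + 1)) * X 1
    + Polynomial.aeval (X 0) (Qseq k n) * X 2) (by simp)
  simp only [map_add, map_mul, ← Polynomial.aeval_algHom_apply, h₁, h₂] at h₃ h₄
  -- Specialise `x₁ ↦ s`, `x₂ ↦ t`, `x₃ ↦ X`.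
  have key (s t : k) : ∃ y : Polynomial k,
      ((Polynomial.C a * Polynomial.C s + Polynomial.C b) * (Pseq k n).comp (Polynomial.C c * Polynomial.X + Polynomial.C d)
        + y * (Pseq k (n + 1)).comp (Polynomial.C c * Polynomial.X + Polynomial.C d))
      = Polynomial.C e * (Polynomial.C s * Pseq k n + Polynomial.C t * Pseq k (n + 1))
        + Polynomial.C f := by
    let φ : MvPolynomial (Fin 3) k →ₐ[k] Polynomial k :=
      aeval ![Polynomial.C s, Polynomial.C t, Polynomial.X]
    refine ⟨φ (σ (X 1)), ?_⟩
    have := congrArg φ h₃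
    simpa [φ, ← Polynomial.aeval_algHom_apply, Polynomial.aeval_X_left,
      ← Polynomial.comp_eq_aeval, ← Polynomial.algebraMap_eq] using this
  obtain ⟨y₀₀, k₀₀⟩ := key 0 0
  obtain ⟨y₁₀, k₁₀⟩ := key 1 0
  obtain ⟨y₀₁, k₀₁⟩ := key 0 1
  have hP := Pseq_ne_zero k n
  obtain ⟨m, hm⟩ : ∃ m, y₀₁ - y₀₀ = Polynomial.C m := by
    have hdiff : (y₀₁ - y₀₀) *
        (Pseq k (n + 1)).comp (Polynomial.C c * Polynomial.X + Polynomial.C d) =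
        Polynomial.C e * Pseq k (n + 1) := by
      simp only [map_zero, map_one] at k₀₀ k₀₁
      linear_combination k₀₁ - k₀₀
    have hne₀ : Polynomial.C e * Pseq k (n + 1) ≠ 0 :=
      mul_ne_zero (Polynomial.C_ne_zero.2 he) hP
    have hdeg := congrArg Polynomial.natDegree hdiff
    rw [← hdiff] at hne₀
    rw [Polynomial.natDegree_mul (left_ne_zero_of_mul hne₀) (right_ne_zero_of_mul hne₀),
      Polynomial.natDegree_comp, Polynomial.natDegree_linear hc, Polynomial.natDegree_C_mul he,
      natDegree_Pseq] at hdeg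
    exact ⟨_, Polynomial.eq_C_of_natDegree_eq_zero (by omega)⟩
  have hcomp : Polynomial.C (m / e) *
      (Pseq k (n + 1)).comp (Polynomial.C c * Polynomial.X + Polynomial.C d) =
      Pseq k (n + 1) := by
    apply mul_left_cancel₀ (Polynomial.C_ne_zero.2 he)
    rw [← mul_assoc, ← Polynomial.C_mul, mul_div_cancel₀ _ he, ← hm]
    simp only [map_zero, map_one] at k₀₀ k₀₁
    linear_combination k₀₁ - k₀₀
  have hl : m / e ≠ 0 := by
    intro h₀
    rw [h₀, map_zero, zero_mul] at hcomp
    exact hP hcomp.symm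
  obtain rfl := eq_zero_of_Pseq_comp_affine hn hne hc hl hcomp
  simp only [map_zero, add_zero] at *
  obtain ⟨hl₁, hc₁⟩ := sq_eq_one_of_Pseq_comp_C_mul_X hn hne hcomp
  rw [hl₁, map_one, one_mul] at hcomp
  have hcomp' : (Pseq k n).comp (Polynomial.C c * Polynomial.X) = Polynomial.C c * Pseq k n := by
    rcases hc₁ with rfl | rfl
    · simp
    · simpa [pow_succ, hne.neg_one_pow] using Pseq_comp_neg_X k n
  simp only [hcomp, hcomp'] at k₀₀ k₁₀
  obtain ⟨i, rfl⟩ : ∃ i, n = i + 1 + 1 := ⟨n - 2, by omega⟩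
  have hlt (u v : k) : (Polynomial.C u * Pseq k (i + 1 + 1) + Polynomial.C v).natDegree <
      (Pseq k (i + 1 + 1 + 1)).natDegree := by
    rw [Polynomial.natDegree_add_C, natDegree_Pseq]
    exact (Polynomial.natDegree_C_mul_le _ _).trans_lt (by rw [natDegree_Pseq]; omega)
  have hcoeff {u v : k} (h₀ : Polynomial.C u * Pseq k (i + 1 + 1) + Polynomial.C v = 0) :
      u = 0 ∧ v = 0 := by
    have := congrArg (Polynomial.coeff · (i + 1)) h₀
    have hu : u = 0 := by simpa [coeff_Pseq_self, Polynomial.coeff_C] using this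
    exact ⟨hu, by simpa [hu] using h₀⟩
  obtain ⟨hb, rfl⟩ := hcoeff (eq_zero_of_mul_eq_of_natDegree_lt (r := y₀₀)
    (by simp only [map_neg, map_mul] at k₀₀ ⊢; linear_combination k₀₀)
    (hlt (-(b * c)) f))
  obtain rfl : b = 0 := by simpa [hc] using hb
  obtain ⟨hac, -⟩ := hcoeff (eq_zero_of_mul_eq_of_natDegree_lt (r := y₁₀)
    (by simp only [map_zero, map_one, map_sub, map_mul] at k₁₀ ⊢
        linear_combination k₁₀)
    (hlt (e - a * c) 0))
  obtain rfl : e = a * c := sub_eq_zero.1 hac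
  have hX₁ : σ (X 1) = C (a * c) * X 1 := by
    have e₁ : Polynomial.aeval (C c * X 2 : MvPolynomial (Fin 3) k) (Pseq k (i + 1 + 1 + 1)) =
        Polynomial.aeval (X 2) (Pseq k (i + 1 + 1 + 1)) := by
      conv_rhs => rw [← hcomp]
      simp [Polynomial.aeval_comp, algebraMap_eq]
    have e₂ : Polynomial.aeval (C c * X 2 : MvPolynomial (Fin 3) k) (Pseq k (i + 1 + 1)) =
        C c * Polynomial.aeval (X 2) (Pseq k (i + 1 + 1)) := by
      have := congrArg (Polynomial.aeval (X 2 : MvPolynomial (Fin 3) k)) hcomp'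
      simpa [Polynomial.aeval_comp, algebraMap_eq] using this
    have hP₂ : Polynomial.aeval (X 2 : MvPolynomial (Fin 3) k) (Pseq k (i + 1 + 1 + 1)) ≠ 0 := by
      intro h₀
      have := congrArg (aeval fun _ : Fin 3 => (Polynomial.X : Polynomial k)) h₀
      rw [← Polynomial.aeval_algHom_apply] at this
      exact hP (by simpa using this)
    rw [e₁, e₂] at h₃
    apply mul_right_cancel₀ hP₂
    simp only [map_zero, map_mul] at h₃ ⊢
    linear_combination h₃
  -- Specialise `x₁ ↦ X`, `x₂ ↦ t`, `x₃ ↦ 0`.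
  have key' (t : k) : (Qseq k (i + 1 + 1 + 1)).comp (Polynomial.C a * Polynomial.X) *
      (Polynomial.C a * Polynomial.C c * Polynomial.C t) =
      Polynomial.C g * (Qseq k (i + 1 + 1 + 1) * Polynomial.C t) + Polynomial.C h := by
    let φ : MvPolynomial (Fin 3) k →ₐ[k] Polynomial k :=
      aeval ![Polynomial.X, Polynomial.C t, 0]
    have := congrArg φ h₄
    simpa [φ, hX₁, ← Polynomial.aeval_algHom_apply, Polynomial.aeval_X_left,
      ← Polynomial.comp_eq_aeval, ← Polynomial.algebraMap_eq] using this
  have hh : h = 0 := by simpa using (key' 0).symm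
  have hQ := key' 1
  rw [hh, Qseq_eq_Pseq_of_even hne, map_one, mul_one, mul_one, ← Polynomial.C_mul, map_zero, add_zero] at hQ
  obtain ⟨-, ha₁⟩ := sq_eq_one_of_Pseq_comp_C_mul_X (l := a * c / g) (c := a) hn hne (by
    apply mul_left_cancel₀ (Polynomial.C_ne_zero.2 hg)
    rw [← mul_assoc, ← Polynomial.C_mul, mul_div_cancel₀ _ hg, ← hQ, mul_comm])
  exact ⟨a, c, ha₁, hc₁, by simpa using h₁, hX₁, by simpa using h₂⟩

/-- Any automorphism `σ` fixing the four vertices of the axis segment is diagonal with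
entries `±1`; in particular there are at most four such automorphisms. -/
theorem axis_stabiliser_finite (k : Type) [Field k] [CharZero k]
    (n : ℕ) (hn : 2 ≤ n) (hne : Even n) :
    (∀ σ : MvPolynomial (Fin 3) k ≃ₐ[k] MvPolynomial (Fin 3) k,
      FixesAxisSegment k n σ →
        ∃ a c : k, (a = 1 ∨ a = -1) ∧ (c = 1 ∨ c = -1) ∧
          σ (X 0) = C a * X 0 ∧ σ (X 1) = C (a * c) * X 1 ∧ σ (X 2) = C c * X 2) ∧
    {σ : MvPolynomial (Fin 3) k ≃ₐ[k] MvPolynomial (Fin 3) k |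
      FixesAxisSegment k n σ}.Finite ∧
    {σ : MvPolynomial (Fin 3) k ≃ₐ[k] MvPolynomial (Fin 3) k |
      FixesAxisSegment k n σ}.ncard ≤ 4 := by
  have hdiag (σ : MvPolynomial (Fin 3) k ≃ₐ[k] MvPolynomial (Fin 3) k)
      (hσ : FixesAxisSegment k n σ) := hσ.diagonal hn hne
  let T : Set (MvPolynomial (Fin 3) k × MvPolynomial (Fin 3) k) :=
    {X 0, -X 0} ×ˢ {X 2, -X 2}
  let ev (σ : MvPolynomial (Fin 3) k ≃ₐ[k] MvPolynomial (Fin 3) k) := (σ (X 0), σ (X 2))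
  have hT : T.Finite := Set.toFinite _
  have hmaps : Set.MapsTo ev {σ | FixesAxisSegment k n σ} T := by
    intro σ hσ
    obtain ⟨a, c, ha, hc, h₀, -, h₂⟩ := hdiag σ hσ
    refine ⟨?_, ?_⟩
    · rcases ha with rfl | rfl <;> simp [ev, h₀]
    · rcases hc with rfl | rfl <;> simp [ev, h₂]
  have hinj : Set.InjOn ev {σ | FixesAxisSegment k n σ} := by
    intro σ hσ τ hτ h
    obtain ⟨a, c, -, -, h₀, h₁, h₂⟩ := hdiag σ hσ
    obtain ⟨a', c', -, -, h₀', h₁', h₂'⟩ := hdiag τ hτ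
    obtain ⟨e₀, e₂⟩ := Prod.ext_iff.1 h
    simp only [ev, h₀, h₀', h₂, h₂'] at e₀ e₂
    obtain rfl := C_injective _ _ (mul_right_cancel₀ (X_ne_zero _) e₀)
    obtain rfl := C_injective _ _ (mul_right_cancel₀ (X_ne_zero _) e₂)
    apply AlgEquiv.coe_toAlgHom_injective
    apply MvPolynomial.algHom_ext
    intro i
    fin_cases i
    · simpa using h₀.trans h₀'.symm
    · simpa using h₁.trans h₁'.symm
    · simpa using h₂.trans h₂'.symm
  refine ⟨hdiag, Set.Finite.of_injOn hmaps hinj hT, ?_⟩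
  calc _ ≤ T.ncard := Set.ncard_le_ncard_of_injOn ev hmaps hinj hT
    _ ≤ 2 * 2 := by
      rw [Set.ncard_prod]
      refine Nat.mul_le_mul ?_ ?_ <;>
        exact (Set.ncard_insert_le _ _).trans (by rw [Set.ncard_singleton])
    _ = 4 := rfl
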